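/- arXiv:math/0110186 — 2 statements merged into one kernel-verified Lean document; each statement's English description precedes it below -/
import Mathlib

section
/- Suppose that for each k ∈ ℤ the map ξ ↦ P_ξ(k) is continuous on [0,1], and that for every ξ ∈ [0,1] there exists k ∈ ℤ with P_ξ(k) > 0. Then there exists δ > 0 such that for every ξ ∈ [0,1] there is k(ξ) ∈ ℤ with P_ξ(k(ξ)) ≥ δ, and consequently ∑_{k∈ℤ} P_ξ(k) = 1 for every ξ ∈ [0,1]. -/
open MeasureTheory Filter Topology Finset

/-- The partial product `∏_{j=1}^{N} M (x / 2^j)`. -/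
noncomputable def dyadicProd (M : ℝ → ℝ) (N : ℕ) (x : ℝ) : ℝ :=
  ∏ j ∈ Finset.range N, M (x / 2 ^ (j + 1))

theorem dyadicProd_nonneg {M : ℝ → ℝ} (hM : ∀ x, 0 ≤ M x) (N : ℕ) (x : ℝ) :
    0 ≤ dyadicProd M N x :=
  Finset.prod_nonneg fun _ _ => hM _

theorem dyadicProd_add (M : ℝ → ℝ) (N n : ℕ) (x : ℝ) :
    dyadicProd M (N + n) x = dyadicProd M N x * dyadicProd M n (x / 2 ^ N) := by
  unfold dyadicProd
  rw [Finset.prod_range_add]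
  congr 1
  refine Finset.prod_congr rfl fun j _ => ?_
  rw [div_div, ← pow_add, add_assoc]

theorem dyadicProd_add_two_pow_mul {M : ℝ → ℝ} (hM : Function.Periodic M 1) (N : ℕ) (x : ℝ)
    (m : ℤ) : dyadicProd M N (x + 2 ^ N * m) = dyadicProd M N x := by
  refine Finset.prod_congr rfl fun j hj => ?_
  obtain ⟨d, rfl⟩ := Nat.exists_eq_add_of_lt (Finset.mem_range.1 hj)
  have h : (x + 2 ^ (j + d + 1) * (m : ℝ)) / 2 ^ (j + 1)
      = x / 2 ^ (j + 1) + ((2 ^ d * m : ℤ) : ℝ) * 1 := by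
    push_cast
    field_simp
    ring
  rw [h]
  exact hM.int_mul _ _

theorem sum_dyadicProd {M : ℝ → ℝ} (hM : Function.Periodic M 1)
    (hMsum : ∀ ξ : ℝ, M ξ + M (ξ + 1 / 2) = 1) (N : ℕ) (x : ℝ) :
    ∑ r ∈ Finset.range (2 ^ N), dyadicProd M N (x + r) = 1 := by
  induction N with
  | zero => simp [dyadicProd]
  | succ N ih =>
    rw [pow_succ, mul_two, Finset.sum_range_add, ← Finset.sum_add_distrib, ← ih]
    refine Finset.sum_congr rfl fun r _ => ?_
    have hsucc (y : ℝ) : dyadicProd M (N + 1) y = dyadicProd M N y * M (y / 2 ^ (N + 1)) :=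
      Finset.prod_range_succ _ _
    have hshift : x + ((2 ^ N + r : ℕ) : ℝ) = x + r + 2 ^ N * ((1 : ℤ) : ℝ) := by
      push_cast
      ring
    have hhalf : (x + r + 2 ^ N * ((1 : ℤ) : ℝ)) / 2 ^ (N + 1)
        = (x + r) / 2 ^ (N + 1) + 1 / 2 := by
      push_cast
      field_simp
      ring
    rw [hshift, hsucc, hsucc, dyadicProd_add_two_pow_mul hM, hhalf, ← mul_add, hMsum, mul_one]

/-- On a compact set, a family of continuous functions of which at least one is positive at each
point admits a uniform positive lower bound. -/
theorem IsCompact.exists_forall_exists_le_of_pos {X ι : Type*} [TopologicalSpace X] {s : Set X}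
    (hs : IsCompact s) {f : ι → X → ℝ} (hf : ∀ i, ContinuousOn (f i) s)
    (hpos : ∀ x ∈ s, ∃ i, 0 < f i x) : ∃ δ > 0, ∀ x ∈ s, ∃ i, δ ≤ f i x := by
  refine hs.induction_on (p := fun t => ∃ δ > 0, ∀ x ∈ t, ∃ i, δ ≤ f i x) ?_ ?_ ?_ ?_
  · exact ⟨1, one_pos, by simp⟩
  · rintro t u htu ⟨δ, hδ, h⟩
    exact ⟨δ, hδ, fun x hx => h x (htu hx)⟩
  · rintro t u ⟨δ, hδ, h⟩ ⟨ε, hε, h'⟩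
    refine ⟨min δ ε, lt_min hδ hε, ?_⟩
    rintro x (hx | hx)
    · obtain ⟨i, hi⟩ := h x hx
      exact ⟨i, (min_le_left _ _).trans hi⟩
    · obtain ⟨i, hi⟩ := h' x hx
      exact ⟨i, (min_le_right _ _).trans hi⟩
  · intro x hx
    obtain ⟨i, hi⟩ := hpos x hx
    exact ⟨{y | f i x / 2 < f i y}, (hf i x hx).eventually_const_lt (half_lt_self hi),
      f i x / 2, half_pos hi, fun y hy => ⟨i, le_of_lt hy⟩⟩

theorem eventually_subset_image_range_two_pow (A : Finset ℤ) :
    ∃ a : ℤ, ∀ᶠ N : ℕ in atTop,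
      A ⊆ (Finset.range (2 ^ N)).image fun r : ℕ => a + (r : ℤ) := by
  obtain ⟨a, ha⟩ := A.bddBelow
  obtain ⟨b, hb⟩ := A.bddAbove
  refine ⟨a, eventually_atTop.2 ⟨(b - a).toNat, fun N hN k hk => ?_⟩⟩
  have hak : a ≤ k := ha hk
  have hkb : k ≤ b := hb hk
  have hlt := Nat.lt_two_pow_self (n := N)
  refine Finset.mem_image.2 ⟨(k - a).toNat, Finset.mem_range.2 ?_, ?_⟩ <;> omega

theorem eq_of_add_two_pow_mul_eq {N : ℕ} {a k l m n : ℤ}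
    (hk : k ∈ (Finset.range (2 ^ N)).image fun r : ℕ => a + (r : ℤ))
    (hl : l ∈ (Finset.range (2 ^ N)).image fun r : ℕ => a + (r : ℤ))
    (h : k + 2 ^ N * m = l + 2 ^ N * n) : k = l := by
  obtain ⟨r, hr, rfl⟩ := Finset.mem_image.1 hk
  obtain ⟨s, hs, rfl⟩ := Finset.mem_image.1 hl
  have hmod : r ≡ s [MOD 2 ^ N] := by
    rw [← Int.natCast_modEq_iff, Int.modEq_iff_dvd]
    refine ⟨m - n, ?_⟩
    push_cast
    linarith
  rw [hmod.eq_of_lt_of_lt (Finset.mem_range.1 hr) (Finset.mem_range.1 hs)]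

section Limit

variable {M : ℝ → ℝ} {P : ℝ → ℤ → ℝ}

theorem limit_add_two_pow_mul (hM : Function.Periodic M 1)
    (hP : ∀ ξ (k : ℤ), Tendsto (fun N => dyadicProd M N (ξ + k)) atTop (𝓝 (P ξ k)))
    (N : ℕ) (ξ : ℝ) (k m : ℤ) :
    P ξ (k + 2 ^ N * m) = dyadicProd M N (ξ + k) * P ((ξ + k) / 2 ^ N) m := by
  refine tendsto_nhds_unique ((tendsto_add_atTop_iff_nat N).2 (hP ξ (k + 2 ^ N * m)))
    (((hP ((ξ + k) / 2 ^ N) m).const_mul (dyadicProd M N (ξ + k))).congr fun n => ?_)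
  have hcast : ξ + ((k + 2 ^ N * m : ℤ) : ℝ) = ξ + k + 2 ^ N * (m : ℝ) := by
    push_cast
    ring
  rw [add_comm n N, dyadicProd_add, hcast, dyadicProd_add_two_pow_mul hM,
    add_div (ξ + k) (2 ^ N * (m : ℝ)), mul_div_cancel_left₀ _ (by positivity)]

theorem exists_le_limit_of_Icc
    (hP : ∀ ξ (k : ℤ), Tendsto (fun N => dyadicProd M N (ξ + k)) atTop (𝓝 (P ξ k)))
    {δ : ℝ} (hδ : ∀ ξ ∈ Set.Icc (0 : ℝ) 1, ∃ k, δ ≤ P ξ k) (y : ℝ) : ∃ k, δ ≤ P y k := by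
  obtain ⟨k, hk⟩ := hδ (Int.fract y) ⟨Int.fract_nonneg y, (Int.fract_lt_one y).le⟩
  refine ⟨k - ⌊y⌋, hk.trans_eq (tendsto_nhds_unique (hP _ _) ((hP y (k - ⌊y⌋)).congr fun N => ?_))⟩
  congr 1
  rw [Int.fract]
  push_cast
  ring

theorem sum_limit_le_one (hM : Function.Periodic M 1) (hM0 : ∀ x, 0 ≤ M x)
    (hMsum : ∀ ξ : ℝ, M ξ + M (ξ + 1 / 2) = 1)
    (hP : ∀ ξ (k : ℤ), Tendsto (fun N => dyadicProd M N (ξ + k)) atTop (𝓝 (P ξ k)))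
    (ξ : ℝ) (A : Finset ℤ) : ∑ k ∈ A, P ξ k ≤ 1 := by
  obtain ⟨a, ha⟩ := eventually_subset_image_range_two_pow A
  refine le_of_tendsto (tendsto_finsetSum A fun k _ => hP ξ k) (ha.mono fun N hN => ?_)
  refine (Finset.sum_le_sum_of_subset_of_nonneg hN
    fun _ _ _ => dyadicProd_nonneg hM0 _ _).trans_eq ?_
  rw [Finset.sum_image fun _ _ _ _ h => by simpa using h, ← sum_dyadicProd hM hMsum N (ξ + a)]
  simp [add_assoc]

theorem hasSum_limit (hM : Function.Periodic M 1) (hM0 : ∀ x, 0 ≤ M x)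
    (hMsum : ∀ ξ : ℝ, M ξ + M (ξ + 1 / 2) = 1)
    (hP : ∀ ξ (k : ℤ), Tendsto (fun N => dyadicProd M N (ξ + k)) atTop (𝓝 (P ξ k)))
    {δ : ℝ} (hδ0 : 0 < δ) (hδ : ∀ y, ∃ k, δ ≤ P y k) (ξ : ℝ) : HasSum (P ξ) 1 := by
  have hP0 (k : ℤ) : 0 ≤ P ξ k :=
    ge_of_tendsto' (hP ξ k) fun N => dyadicProd_nonneg hM0 N _
  have hle := sum_limit_le_one hM hM0 hMsum hP ξ
  have hsummable : Summable (P ξ) := summable_of_sum_le hP0 hle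
  have hA (A : Finset ℤ) : ∑ k ∈ A, P ξ k + δ * (1 - ∑ k ∈ A, P ξ k) ≤ ∑' k, P ξ k := by
    obtain ⟨a, ha⟩ := eventually_subset_image_range_two_pow A
    refine le_of_tendsto (tendsto_const_nhds.add (tendsto_const_nhds.mul
      (tendsto_const_nhds.sub (tendsto_finsetSum A fun k _ => hP ξ k))))
      (ha.mono fun N hN => ?_)
    set I := (Finset.range (2 ^ N)).image fun r : ℕ => a + (r : ℤ) with hI
    have hsumI : ∑ k ∈ I, dyadicProd M N (ξ + k) = 1 := by
      rw [hI, Finset.sum_image fun _ _ _ _ h => by simpa using h,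
        ← sum_dyadicProd hM hMsum N (ξ + a)]
      simp [add_assoc]
    choose m hm using fun k : ℤ => hδ ((ξ + k) / 2 ^ N)
    have hinj : Set.InjOn (fun k => k + 2 ^ N * m k) (I \ A : Finset ℤ) := fun k hk l hl h =>
      eq_of_add_two_pow_mul_eq (Finset.mem_sdiff.1 hk).1 (Finset.mem_sdiff.1 hl).1 h
    have hdisj : Disjoint A ((I \ A).image fun k => k + 2 ^ N * m k) := by
      refine Finset.disjoint_left.2 fun l hl hl' => ?_
      obtain ⟨k, hk, hkl⟩ := Finset.mem_image.1 hl'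
      rw [Finset.mem_sdiff] at hk
      have hkl' : k = l := eq_of_add_two_pow_mul_eq (n := 0) hk.1 (hN hl) (by simpa using hkl)
      exact hk.2 (hkl' ▸ hl)
    calc ∑ k ∈ A, P ξ k + δ * (1 - ∑ k ∈ A, dyadicProd M N (ξ + k))
        = ∑ k ∈ A, P ξ k + ∑ k ∈ I \ A, δ * dyadicProd M N (ξ + k) := by
          rw [← Finset.mul_sum, ← hsumI, ← Finset.sum_sdiff hN, add_sub_cancel_right]
      _ ≤ ∑ k ∈ A, P ξ k + ∑ k ∈ I \ A, P ξ (k + 2 ^ N * m k) := by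
          gcongr with k _
          rw [limit_add_two_pow_mul hM hP, mul_comm]
          exact mul_le_mul_of_nonneg_left (hm k) (dyadicProd_nonneg hM0 _ _)
      _ = ∑ k ∈ A ∪ (I \ A).image fun k => k + 2 ^ N * m k, P ξ k := by
          rw [Finset.sum_union hdisj, Finset.sum_image hinj]
      _ ≤ ∑' k, P ξ k := hsummable.sum_le_tsum _ fun k _ => hP0 k
  have hlim : ∑' k, P ξ k + δ * (1 - ∑' k, P ξ k) ≤ ∑' k, P ξ k :=
    le_of_tendsto' (Tendsto.add hsummable.hasSum (tendsto_const_nhds.mul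
      (tendsto_const_nhds.sub hsummable.hasSum))) hA
  have hone : ∑' k, P ξ k = 1 :=
    le_antisymm (hsummable.tsum_le_of_sum_le hle) (by nlinarith)
  exact hone ▸ hsummable.hasSum

end Limit

/-- if each `ξ ↦ P_ξ(k)` is continuous on `[0,1]` and every
`ξ ∈ [0,1]` has some `k` with `P_ξ(k) > 0`, then there is a uniform `δ > 0`
with `P_ξ(k(ξ)) ≥ δ` for every `ξ ∈ [0,1]`, and consequently
`∑_{k∈ℤ} P_ξ(k) = 1` for every `ξ ∈ [0,1]`. -/
theorem statement11 (M : ℝ → ℝ)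
    (hM01 : ∀ ξ : ℝ, M ξ ∈ Set.Icc (0 : ℝ) 1)
    (hMmeas : Measurable M)
    (hMper : ∀ ξ : ℝ, M (ξ + 1) = M ξ)
    (hMsum : ∀ ξ : ℝ, M ξ + M (ξ + 1 / 2) = 1)
    (hM0 : M 0 = 1)
    (P : ℝ → ℤ → ℝ)
    (hP : ∀ (ξ : ℝ) (k : ℤ),
      Filter.Tendsto (fun N : ℕ => ∏ j ∈ Finset.range (N + 1), M ((ξ + (k : ℝ)) / 2 ^ (j + 1)))
        atTop (𝓝 (P ξ k)))
    (hcont : ∀ k : ℤ, ContinuousOn (fun ξ => P ξ k) (Set.Icc (0 : ℝ) 1))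
    (hpos : ∀ ξ ∈ Set.Icc (0 : ℝ) 1, ∃ k : ℤ, 0 < P ξ k) :
    (∃ δ > (0 : ℝ), ∀ ξ ∈ Set.Icc (0 : ℝ) 1, ∃ k : ℤ, δ ≤ P ξ k) ∧
    (∀ ξ ∈ Set.Icc (0 : ℝ) 1, ∑' k : ℤ, P ξ k = 1) := by
  have hP' (ξ : ℝ) (k : ℤ) : Tendsto (fun N => dyadicProd M N (ξ + k)) atTop (𝓝 (P ξ k)) :=
    (tendsto_add_atTop_iff_nat 1).1 (hP ξ k)
  obtain ⟨δ, hδ0, hδ⟩ :=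
    isCompact_Icc.exists_forall_exists_le_of_pos (f := fun k ξ => P ξ k) hcont hpos
  exact ⟨⟨δ, hδ0, hδ⟩, fun ξ _ => (hasSum_limit hMper (fun x => (hM01 x).1) hMsum hP' hδ0
    (exists_le_limit_of_Icc hP' hδ) ξ).tsum_eq⟩
end

section
/- Fix ξ ∈ [0,1). Then ∑_{k∈ℤ} P_ξ(k) = 1 if and only if the family {P^N_ξ : N ≥ 0} is tight, i.e., for every ε > 0 there exists an integer n ≥ 1 such that for every N ≥ 0, ∑ { P^N_ξ(k) : k ∈ ℤ, −2^N ≤ k < 2^N, |k| ≥ n } ≤ ε. -/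
open MeasureTheory Filter Topology Finset

/-- Summing the `n`-fold partial products over a full period of length `2 ^ n` gives `1`. -/
theorem sum_range_prod_dyadic_eq_one {M : ℝ → ℝ} (hMper : ∀ x, M (x + 1) = M x)
    (hMsum : ∀ x, M x + M (x + 1 / 2) = 1) (x : ℝ) (n : ℕ) :
    ∑ k ∈ range (2 ^ n), ∏ j ∈ range n, M ((x + (k : ℝ)) / 2 ^ (j + 1)) = 1 := by
  induction n with
  | zero => simp
  | succ n ih =>
    rw [pow_succ, mul_two, sum_range_add, ← sum_add_distrib, ← ih]
    refine sum_congr rfl fun k _ => ?_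
    have hshift : ∏ j ∈ range n, M ((x + ((2 ^ n + k : ℕ) : ℝ)) / 2 ^ (j + 1)) =
        ∏ j ∈ range n, M ((x + (k : ℝ)) / 2 ^ (j + 1)) := by
      refine prod_congr rfl fun j hj => ?_
      obtain ⟨d, rfl⟩ := Nat.exists_eq_add_of_lt (mem_range.mp hj)
      have hper : Function.Periodic M 1 := hMper
      rw [← hper.nat_mul (2 ^ d) ((x + (k : ℝ)) / 2 ^ (j + 1))]
      congr 1
      push_cast
      field_simp
      ring
    have hhalf : (x + ((2 ^ n + k : ℕ) : ℝ)) / 2 ^ (n + 1) =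
        (x + (k : ℝ)) / 2 ^ (n + 1) + 1 / 2 := by
      push_cast
      field_simp
      ring
    rw [prod_range_succ, prod_range_succ, hshift, hhalf, ← mul_add, hMsum, mul_one]

/-- The partial products sum to `1` over the symmetric dyadic window. -/
theorem sum_Ico_prod_dyadic_eq_one {M : ℝ → ℝ} (hMper : ∀ x, M (x + 1) = M x)
    (hMsum : ∀ x, M x + M (x + 1 / 2) = 1) (x : ℝ) (N : ℕ) :
    ∑ k ∈ Ico (-(2 ^ N) : ℤ) (2 ^ N),
      ∏ j ∈ range (N + 1), M ((x + (k : ℝ)) / 2 ^ (j + 1)) = 1 := by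
  rw [← sum_range_prod_dyadic_eq_one hMper hMsum (x - 2 ^ N) (N + 1)]
  symm
  refine sum_bij (fun k _ => (k : ℤ) - 2 ^ N) ?_ ?_ ?_ ?_
  · intro k hk
    have hk' : (k : ℤ) < 2 ^ (N + 1) := by exact_mod_cast mem_range.mp hk
    rw [mem_Ico]
    constructor <;> [skip; rw [pow_succ] at hk'] <;> omega
  · intro a _ b _ hab
    simpa using hab
  · intro k hk
    rw [mem_Ico] at hk
    refine ⟨(k + 2 ^ N).toNat, ?_, ?_⟩
    · rw [mem_range]
      zify
      rw [Int.toNat_of_nonneg (by omega), pow_succ]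
      omega
    · rw [Int.toNat_of_nonneg (by omega)]
      ring
  · intro k _
    refine prod_congr rfl fun j _ => ?_
    congr 2
    push_cast
    ring

/-- Let `Q N` be nonnegative functions on `ℤ` of total mass `1` on `[-2 ^ N, 2 ^ N)` that converge
pointwise from above to `p`. Then `p` has total mass `1` if and only if the `Q N` are tight. -/
theorem tsum_eq_one_iff_tight_of_le {Q : ℕ → ℤ → ℝ} {p : ℤ → ℝ}
    (hp : ∀ k, 0 ≤ p k) (hle : ∀ N k, p k ≤ Q N k)
    (hlim : ∀ k, Tendsto (fun N => Q N k) atTop (𝓝 (p k)))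
    (hsum : ∀ N, ∑ k ∈ Ico (-(2 ^ N) : ℤ) (2 ^ N), Q N k = 1) :
    ∑' k, p k = 1 ↔
      ∀ ε > (0 : ℝ), ∃ n : ℕ, 1 ≤ n ∧ ∀ N : ℕ,
        ∑ k ∈ (Ico (-(2 ^ N) : ℤ) (2 ^ N)).filter (fun k => (n : ℤ) ≤ |k|), Q N k ≤ ε := by
  have hsplit (n N : ℕ) (hn : (n : ℤ) ≤ 2 ^ N) :
      ∑ k ∈ (Ico (-(2 ^ N) : ℤ) (2 ^ N)).filter (fun k => (n : ℤ) ≤ |k|), Q N k +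
        ∑ k ∈ Ioo (-(n : ℤ)) n, Q N k = 1 := by
    rw [← hsum N, ← sum_filter_add_sum_filter_not (Ico (-(2 ^ N) : ℤ) (2 ^ N))
      (fun k => (n : ℤ) ≤ |k|)]
    congr 2
    ext k
    simp only [mem_Ioo, mem_filter, mem_Ico, not_le, abs_lt]
    omega
  have hbound (s : Finset ℤ) : ∃ n : ℕ, 1 ≤ n ∧ s ⊆ Ioo (-(n : ℤ)) n := by
    refine ⟨s.sup Int.natAbs + 1, by omega, fun k hk => ?_⟩
    have := le_sup (f := Int.natAbs) hk
    rw [mem_Ioo]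
    omega
  have hpow (n : ℕ) : (n : ℤ) ≤ 2 ^ n := by exact_mod_cast Nat.lt_two_pow_self.le
  have hfin (s : Finset ℤ) : ∑ k ∈ s, p k ≤ 1 := by
    obtain ⟨n, -, hn⟩ := hbound s
    have htail : 0 ≤ ∑ k ∈ (Ico (-(2 ^ n) : ℤ) (2 ^ n)).filter (fun k => (n : ℤ) ≤ |k|), Q n k :=
      sum_nonneg fun k _ => (hp k).trans (hle n k)
    have h₁ : ∑ k ∈ s, p k ≤ ∑ k ∈ Ioo (-(n : ℤ)) n, p k :=
      sum_le_sum_of_subset_of_nonneg hn fun k _ _ => hp k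
    have h₂ : ∑ k ∈ Ioo (-(n : ℤ)) n, p k ≤ ∑ k ∈ Ioo (-(n : ℤ)) n, Q n k :=
      sum_le_sum fun k _ => hle n k
    linarith [hsplit n n (hpow n)]
  have hsummable : Summable p := summable_of_sum_le hp hfin
  constructor
  · intro h ε hε
    have hs : HasSum p 1 := h ▸ hsummable.hasSum
    obtain ⟨s, hs⟩ := (hs.eventually (lt_mem_nhds (sub_lt_self 1 hε))).exists
    obtain ⟨n, hn₁, hn⟩ := hbound s
    refine ⟨n, hn₁, fun N => ?_⟩
    by_cases hN : (n : ℤ) ≤ 2 ^ N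
    · have h₁ : ∑ k ∈ s, p k ≤ ∑ k ∈ Ioo (-(n : ℤ)) n, p k :=
        sum_le_sum_of_subset_of_nonneg hn fun k _ _ => hp k
      have h₂ : ∑ k ∈ Ioo (-(n : ℤ)) n, p k ≤ ∑ k ∈ Ioo (-(n : ℤ)) n, Q N k :=
        sum_le_sum fun k _ => hle N k
      linarith [hsplit n N hN]
    · rw [filter_false_of_mem, sum_empty]
      · exact hε.le
      · intro k hk
        rw [mem_Ico] at hk
        rw [not_le, abs_lt]
        omega
  · intro h
    refine le_antisymm (hsummable.tsum_le_of_sum_le hfin) (le_of_forall_pos_sub_le fun ε hε => ?_)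
    obtain ⟨n, -, hn⟩ := h ε hε
    refine le_trans ?_ (hsummable.sum_le_tsum (Ioo (-(n : ℤ)) n) fun k _ => hp k)
    refine ge_of_tendsto (tendsto_finsetSum _ fun k _ => hlim k) ?_
    filter_upwards [eventually_ge_atTop n] with N hN
    have hnN : (n : ℤ) ≤ 2 ^ N := (hpow n).trans (pow_le_pow_right₀ (by norm_num) hN)
    linarith [hsplit n N hnN, hn N]

/-- for fixed `ξ ∈ [0,1)`, `∑_{k∈ℤ} P_ξ(k) = 1` iff the family
`{P^N_ξ}` is tight: for every `ε > 0` there is `n ≥ 1` with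
`∑ {P^N_ξ(k) : −2^N ≤ k < 2^N, |k| ≥ n} ≤ ε` for every `N ≥ 0`. -/
theorem statement15 (M : ℝ → ℝ)
    (hM01 : ∀ ξ : ℝ, M ξ ∈ Set.Icc (0 : ℝ) 1)
    (hMmeas : Measurable M)
    (hMper : ∀ ξ : ℝ, M (ξ + 1) = M ξ)
    (hMsum : ∀ ξ : ℝ, M ξ + M (ξ + 1 / 2) = 1)
    (hM0 : M 0 = 1)
    (P : ℝ → ℤ → ℝ)
    (hP : ∀ (ξ : ℝ) (k : ℤ),
      Filter.Tendsto (fun N : ℕ => ∏ j ∈ Finset.range (N + 1), M ((ξ + (k : ℝ)) / 2 ^ (j + 1)))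
        atTop (𝓝 (P ξ k)))
    (ξ : ℝ) (hξ : ξ ∈ Set.Ico (0 : ℝ) 1) :
    (∑' k : ℤ, P ξ k = 1) ↔
    (∀ ε > (0 : ℝ), ∃ n : ℕ, 1 ≤ n ∧ ∀ N : ℕ,
      ∑ k ∈ (Finset.Ico (-(2 ^ N) : ℤ) (2 ^ N)).filter (fun k => (n : ℤ) ≤ |k|),
        ∏ j ∈ Finset.range (N + 1), M ((ξ + (k : ℝ)) / 2 ^ (j + 1)) ≤ ε) := by
  have hanti (k : ℤ) : Antitone fun N : ℕ =>
      ∏ j ∈ range (N + 1), M ((ξ + (k : ℝ)) / 2 ^ (j + 1)) := by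
    refine antitone_nat_of_succ_le fun N => ?_
    rw [prod_range_succ _ (N + 1)]
    exact mul_le_of_le_one_right (prod_nonneg fun j _ => (hM01 _).1) (hM01 _).2
  exact tsum_eq_one_iff_tight_of_le
    (fun k => ge_of_tendsto' (hP ξ k) fun N => prod_nonneg fun j _ => (hM01 _).1)
    (fun N k => (hanti k).le_of_tendsto (hP ξ k) N) (hP ξ)
    (sum_Ico_prod_dyadic_eq_one hMper hMsum ξ)
end
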